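/- arXiv:1607.04742 — 3 statements merged into one kernel-verified Lean document; each statement's English description precedes it below -/
import Mathlib

section
/- The Gauss hypergeometric series satisfies ₂F₁(1/4, 1/2; 3/4; 80/81) = 9/5, i.e. the sum over n ≥ 0 of ((1/4)_n (1/2)_n / ((3/4)_n n!)) (80/81)^n equals 9/5. -/
open scoped Nat

/-- Pochhammer symbol (rising factorial) on the reals. -/
noncomputable def poch (a : ℝ) (n : ℕ) : ℝ := ∏ i ∈ Finset.range n, (a + i)

/-- Gauss hypergeometric series ₂F₁(a,b;c;x) as a real series. -/
noncomputable def twoFone (a b c x : ℝ) : ℝ :=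
  ∑' n : ℕ, poch a n * poch b n / (poch c n * (n ! : ℝ)) * x ^ n

noncomputable def gL (t : ℝ) : ℝ := 1 / Real.sqrt (1 - t ^ 4)
noncomputable def hL (r : ℝ) : ℝ := 15 / (Real.sqrt (81 - 80 * r ^ 4) * Real.sqrt (1 - r ^ 4))
noncomputable def SL (r : ℝ) : ℝ := (15 * r - 16 * r ^ 5) / Real.sqrt (81 - 80 * r ^ 4)
noncomputable def PhiL (x : ℝ) : ℝ := ∫ t in (0:ℝ)..x, gL t

open MeasureTheory intervalIntegral Set

lemma pow4_lt {t : ℝ} (h : t ∈ Ioo (-1:ℝ) 1) : t ^ 4 < 1 := by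
  have h1 : t ^ 2 < 1 := by nlinarith [h.1, h.2]
  nlinarith [sq_nonneg t]

lemma gL_int : IntervalIntegrable gL volume (-1) 1 := by
  have h1 : IntegrableOn (fun t : ℝ => 1 / Real.sqrt (1 - t ^ 2)) (Ioc (-1) 1) := by
    apply integrableOn_deriv_of_nonneg (g := Real.arcsin) Real.continuous_arcsin.continuousOn
    · intro x hx
      exact Real.hasDerivAt_arcsin hx.1.ne' hx.2.ne
    · intro x hx; positivity
  rw [intervalIntegrable_iff_integrableOn_Ioc_of_le (by norm_num)]
  refine Integrable.mono' h1 ?_ ?_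
  · apply Measurable.aestronglyMeasurable
    unfold gL; fun_prop
  · rw [ae_restrict_iff' measurableSet_Ioc]
    have : ∀ᵐ x : ℝ, x ≠ 1 := by simp [ae_iff]
    filter_upwards [this] with t ht1 ht
    have h2 : t ∈ Ioo (-1:ℝ) 1 := ⟨ht.1, lt_of_le_of_ne ht.2 ht1⟩
    have h1 : t ^ 2 < 1 := by nlinarith [h2.1, h2.2]
    unfold gL
    rw [Real.norm_of_nonneg (by positivity)]
    apply one_div_le_one_div_of_le
    · apply Real.sqrt_pos.mpr; linarith
    · apply Real.sqrt_le_sqrt; nlinarith [sq_nonneg t]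

lemma gL_int01 : IntervalIntegrable gL volume 0 1 := by
  apply gL_int.mono_set
  rw [uIcc_of_le (by norm_num), uIcc_of_le (by norm_num)]
  exact Icc_subset_Icc (by norm_num) le_rfl

lemma Phi_cont : ContinuousOn PhiL (Icc (-1) 1) := by
  have := continuousOn_primitive_interval' (a := 0) gL_int (by rw [uIcc_of_le] <;> norm_num)
  rwa [uIcc_of_le (by norm_num)] at this

lemma Phi_deriv {x : ℝ} (hx : x ∈ Ioo (-1:ℝ) 1) : HasDerivAt PhiL (gL x) x := by
  apply integral_hasDerivAt_right
  · apply gL_int.mono_set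
    rw [uIcc_of_le (a := (-1:ℝ)) (by norm_num)]
    apply uIcc_subset_Icc <;> constructor <;> linarith [hx.1, hx.2]
  · apply Measurable.stronglyMeasurable _ |>.stronglyMeasurableAtFilter
    unfold gL; fun_prop
  · have := pow4_lt hx
    have : Real.sqrt (1 - x ^ 4) ≠ 0 := (Real.sqrt_pos.mpr (by linarith)).ne'
    unfold gL
    fun_prop (disch := assumption)

lemma Phi_neg_one : PhiL (-1) = - PhiL 1 := by
  unfold PhiL
  have := intervalIntegral.integral_comp_neg (a := 0) (b := 1) gL
  have h2 : ∀ x, gL (-x) = gL x := by intro x; unfold gL; congr 3; ring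
  simp only [h2, neg_zero] at this
  rw [this, intervalIntegral.integral_symm]

lemma Phi_one_pos : 0 < PhiL 1 := by
  apply intervalIntegral_pos_of_pos_on gL_int01 _ (by norm_num)
  intro x hx
  have := pow4_lt (t := x) ⟨by linarith [hx.1], hx.2⟩
  unfold gL
  have : 0 < Real.sqrt (1 - x ^ 4) := (Real.sqrt_pos.mpr (by linarith))
  positivity

lemma hL_int : IntervalIntegrable hL volume 0 1 := by
  have h1 := gL_int01.const_mul 15
  rw [intervalIntegrable_iff_integrableOn_Ioc_of_le (by norm_num)] at h1 ⊢
  refine Integrable.mono' h1 ?_ ?_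
  · apply Measurable.aestronglyMeasurable
    unfold hL; fun_prop
  · rw [ae_restrict_iff' measurableSet_Ioc]
    have : ∀ᵐ x : ℝ, x ≠ 1 := by simp [ae_iff]
    filter_upwards [this] with t ht1 ht
    have h2 : t ∈ Ioo (-1:ℝ) 1 := ⟨by linarith [ht.1], lt_of_le_of_ne ht.2 ht1⟩
    have h3 := pow4_lt h2
    have h4 : 0 < Real.sqrt (1 - t ^ 4) := (Real.sqrt_pos.mpr (by linarith))
    have h5 : 1 ≤ Real.sqrt (81 - 80 * t ^ 4) := by
      rw [Real.one_le_sqrt]; linarith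
    unfold gL hL
    rw [Real.norm_of_nonneg (by positivity), mul_one_div]
    apply div_le_div_of_nonneg_left (by norm_num) h4
    nlinarith

lemma one_sub_S4 {r : ℝ} (h : r ^ 4 ≤ 1) :
    1 - SL r ^ 4 = (1 - r ^ 4) * ((256 * r ^ 8 - 352 * r ^ 4 + 81) / (81 - 80 * r ^ 4)) ^ 2 := by
  have hD : 0 < 81 - 80 * r ^ 4 := by linarith
  have h2 : Real.sqrt (81 - 80 * r ^ 4) ^ 4 = (81 - 80 * r ^ 4) ^ 2 := by
    rw [show (4:ℕ) = 2 * 2 by norm_num, pow_mul, Real.sq_sqrt hD.le]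
  unfold SL
  have hne := pow_ne_zero 2 hD.ne'
  rw [div_pow, h2, div_pow, mul_div_assoc', eq_div_iff hne, sub_mul, div_mul_cancel₀ _ hne]
  ring

lemma S_deriv {r : ℝ} (h : r ^ 4 ≤ 1) :
    HasDerivAt SL (15 * (256 * r ^ 8 - 352 * r ^ 4 + 81) /
      ((81 - 80 * r ^ 4) * Real.sqrt (81 - 80 * r ^ 4))) r := by
  have hD : 0 < 81 - 80 * r ^ 4 := by linarith
  have hs : 0 < Real.sqrt (81 - 80 * r ^ 4) := Real.sqrt_pos.mpr hD
  have h1 : HasDerivAt (fun r : ℝ => 15 * r - 16 * r ^ 5) (15 * 1 - 16 * ((5:ℕ) * r ^ 4)) r :=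
    ((hasDerivAt_id r).const_mul 15).sub ((hasDerivAt_pow 5 r).const_mul 16)
  have h2 : HasDerivAt (fun r : ℝ => 81 - 80 * r ^ 4) (- (80 * ((4:ℕ) * r ^ 3))) r :=
    ((hasDerivAt_pow 4 r).const_mul 80).const_sub 81
  have h3 := h1.div (h2.sqrt hD.ne') hs.ne'
  refine h3.congr_deriv ?_
  have hq := Real.sq_sqrt hD.le
  set w := Real.sqrt (81 - 80 * r ^ 4) with hw
  rw [← hq]
  have hr : r ^ 4 = (81 - w ^ 2) / 80 := by linarith
  field_simp
  push_cast
  linear_combination (30 - 160 * r ^ 4) * hq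

lemma S_mem {r : ℝ} (h : r ^ 4 ≤ 1) : SL r ∈ Icc (-1:ℝ) 1 := by
  have := one_sub_S4 h
  have h2 : 0 ≤ 1 - SL r ^ 4 := by rw [this]; apply mul_nonneg; linarith; positivity
  have h3 : SL r ^ 2 ≤ 1 := by
    by_contra hc
    push Not at hc
    nlinarith
  exact abs_le.mp (by rwa [← sq_le_one_iff_abs_le_one])

lemma comp_deriv {r : ℝ} (hr : r ∈ Ioo (0:ℝ) 1) (hN : 256 * r ^ 8 - 352 * r ^ 4 + 81 ≠ 0) :
    HasDerivAt (fun r => PhiL (SL r))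
      ((256 * r ^ 8 - 352 * r ^ 4 + 81) / |256 * r ^ 8 - 352 * r ^ 4 + 81| * hL r) r := by
  have h4 : r ^ 4 < 1 := pow4_lt ⟨by linarith [hr.1], hr.2⟩
  have hD : 0 < 81 - 80 * r ^ 4 := by linarith
  have hs : 0 < Real.sqrt (81 - 80 * r ^ 4) := Real.sqrt_pos.mpr hD
  have hs2 : 0 < Real.sqrt (1 - r ^ 4) := Real.sqrt_pos.mpr (by linarith)
  have e := one_sub_S4 h4.le
  have hpos : 0 < 1 - SL r ^ 4 := by
    rw [e]; apply mul_pos (by linarith); have := hD.ne'; positivity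
  have hm := S_mem h4.le
  have hm' : SL r ∈ Ioo (-1:ℝ) 1 := by
    refine ⟨lt_of_le_of_ne hm.1 ?_, lt_of_le_of_ne hm.2 ?_⟩
    · intro hh; rw [← hh] at hpos; norm_num at hpos
    · intro hh; rw [hh] at hpos; norm_num at hpos
  have := (Phi_deriv hm').comp r (S_deriv h4.le)
  refine this.congr_deriv ?_
  unfold gL hL
  rw [e, Real.sqrt_mul (by linarith), Real.sqrt_sq_eq_abs, abs_div, abs_of_pos hD]
  have hab : |256 * r ^ 8 - 352 * r ^ 4 + 81| ≠ 0 := abs_ne_zero.mpr hN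
  have hne := hD.ne'
  generalize |256 * r ^ 8 - 352 * r ^ 4 + 81| = M at hab ⊢
  generalize Real.sqrt (81 - 80 * r ^ 4) = v at hs ⊢
  generalize 81 - 80 * r ^ 4 = D at hne ⊢
  field_simp

lemma comp_cont {a b : ℝ} (ha : 0 ≤ a) (hb : b ≤ 1) :
    ContinuousOn (fun r => PhiL (SL r)) (Icc a b) := by
  have h : ∀ r ∈ Icc a b, r ^ 4 ≤ 1 := fun r hr =>
    pow_le_one₀ (by linarith [hr.1]) (by linarith [hr.2])
  exact Phi_cont.comp (fun r hr => (S_deriv (h r hr)).continuousAt.continuousWithinAt)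
    (fun r hr => S_mem (h r hr))

lemma int_hL : ∫ r in (0:ℝ)..1, hL r = 3 * PhiL 1 := by
  obtain ⟨w, hw0, hw⟩ : ∃ w : ℝ, 0 < w ∧ w ^ 2 = 10 :=
    ⟨Real.sqrt 10, by positivity, Real.sq_sqrt (by norm_num)⟩
  have hw3 : 3 < w := by nlinarith
  have hw4 : w < 4 := by nlinarith
  obtain ⟨c, hc0, hc⟩ : ∃ c : ℝ, 0 < c ∧ c ^ 2 = (w - 1) / 4 :=
    ⟨Real.sqrt ((w - 1) / 4), Real.sqrt_pos.mpr (by linarith), Real.sq_sqrt (by linarith)⟩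
  have hc1 : c < 1 := by nlinarith
  have hc4 : c ^ 4 = (11 - 2 * w) / 16 := by
    rw [show (4:ℕ) = 2 * 2 by norm_num, pow_mul, hc]; linear_combination hw / 16
  have hNf : ∀ r : ℝ, 256 * r ^ 8 - 352 * r ^ 4 + 81
      = 256 * (r ^ 4 - c ^ 4) * (r ^ 4 - (11 + 2 * w) / 16) := by
    intro r; rw [hc4]; linear_combination 4 * hw
  have hS0 : SL 0 = 0 := by simp [SL]
  have hS1 : SL 1 = -1 := by norm_num [SL]
  have hSc : SL c = 1 := by
    unfold SL
    have : Real.sqrt (81 - 80 * c ^ 4) = 15 * c - 16 * c ^ 5 := by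
      rw [show 15 * c - 16 * c ^ 5 = c * (4 + 2 * w) by
        linear_combination (-16 * c) * hc4]
      rw [Real.sqrt_eq_iff_mul_self_eq (by rw [hc4]; linarith) (by positivity), hc4]
      linear_combination -(4 + 2 * w) ^ 2 * hc - (w + 3) * hw
    rw [this, div_self]
    rw [← this, hc4]
    exact (Real.sqrt_pos.mpr (by linarith)).ne'
  have hi1 : IntervalIntegrable hL volume 0 c := by
    apply hL_int.mono_set
    rw [uIcc_of_le (by linarith), uIcc_of_le (by linarith)]
    exact Icc_subset_Icc le_rfl hc1.le
  have hi2 : IntervalIntegrable hL volume c 1 := by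
    apply hL_int.mono_set
    rw [uIcc_of_le (by linarith), uIcc_of_le (by linarith)]
    exact Icc_subset_Icc hc0.le le_rfl
  have h1 : ∫ r in (0:ℝ)..c, hL r = PhiL (SL c) - PhiL (SL 0) := by
    apply integral_eq_sub_of_hasDerivAt_of_le (f := fun r => PhiL (SL r)) hc0.le
      (comp_cont le_rfl hc1.le) _ hi1
    intro r hr
    have hlt : r ^ 4 < c ^ 4 := pow_lt_pow_left₀ hr.2 hr.1.le (by norm_num)
    have hN : 0 < 256 * r ^ 8 - 352 * r ^ 4 + 81 := by
      rw [hNf]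
      apply mul_pos_of_neg_of_neg <;> linarith
    have := comp_deriv ⟨hr.1, by linarith [hr.2]⟩ hN.ne'
    rwa [abs_of_pos hN, div_self hN.ne', one_mul] at this
  have h2 : ∫ r in c..1, -hL r = PhiL (SL 1) - PhiL (SL c) := by
    apply integral_eq_sub_of_hasDerivAt_of_le (f := fun r => PhiL (SL r)) hc1.le
      (comp_cont hc0.le le_rfl) _ hi2.neg
    intro r hr
    have hr0 : 0 < r := by linarith [hr.1]
    have hlt : c ^ 4 < r ^ 4 := pow_lt_pow_left₀ hr.1 hc0.le (by norm_num)
    have hlt2 : r ^ 4 < 1 := pow4_lt ⟨by linarith, hr.2⟩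
    have hN : 256 * r ^ 8 - 352 * r ^ 4 + 81 < 0 := by
      rw [hNf]
      apply mul_neg_of_pos_of_neg <;> linarith
    have := comp_deriv ⟨hr0, hr.2⟩ hN.ne
    rwa [abs_of_neg hN, div_neg, div_self hN.ne, neg_one_mul] at this
  rw [intervalIntegral.integral_neg] at h2
  rw [← integral_add_adjacent_intervals hi1 hi2, h1]
  rw [hSc, hS0] at *
  rw [hS1, Phi_neg_one] at h2
  have : PhiL 0 = 0 := by simp [PhiL]
  linarith

lemma poch_succ (a : ℝ) (n : ℕ) : poch a (n + 1) = poch a n * (a + n) := by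
  simp [poch, Finset.prod_range_succ]

lemma poch_pos {a : ℝ} (ha : 0 < a) (n : ℕ) : 0 < poch a n :=
  Finset.prod_pos fun i _ => by positivity

lemma gL_mul_int (n : ℕ) : IntervalIntegrable (fun t => t ^ n * gL t) volume 0 1 :=
  gL_int01.continuousOn_mul (by fun_prop)

lemma moment_rec (n : ℕ) : (4 * n + 1 : ℝ) * ∫ t in (0:ℝ)..1, t ^ (4 * n) * gL t
    = (4 * n + 3) * ∫ t in (0:ℝ)..1, t ^ (4 * (n + 1)) * gL t := by
  have h : ∫ t in (0:ℝ)..1, ((4 * n + 1 : ℝ) * (t ^ (4 * n) * gL t)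
      - (4 * n + 3) * (t ^ (4 * (n + 1)) * gL t)) =
      (1:ℝ) ^ (4 * n + 1) * Real.sqrt (1 - 1 ^ 4) - (0:ℝ) ^ (4 * n + 1) * Real.sqrt (1 - 0 ^ 4) := by
    apply integral_eq_sub_of_hasDerivAt_of_le (f := fun t : ℝ => t ^ (4 * n + 1) * Real.sqrt (1 - t ^ 4))
      (by norm_num) (by fun_prop)
    · intro t ht
      have h4 : t ^ 4 < 1 := pow4_lt ⟨by linarith [ht.1], ht.2⟩
      have hD : 0 < 1 - t ^ 4 := by linarith
      have hs : 0 < Real.sqrt (1 - t ^ 4) := Real.sqrt_pos.mpr hD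
      have h2 : HasDerivAt (fun r : ℝ => 1 - r ^ 4) (- ((4:ℕ) * t ^ 3)) t :=
        (hasDerivAt_pow 4 t).const_sub 1
      refine ((hasDerivAt_pow (4 * n + 1) t).mul (h2.sqrt hD.ne')).congr_deriv ?_
      unfold gL
      have hq := Real.sq_sqrt hD.le
      push_cast
      field_simp
      rw [hq]
      ring
    · exact ((gL_mul_int _).const_mul _).sub ((gL_mul_int _).const_mul _)
  rw [intervalIntegral.integral_sub ((gL_mul_int _).const_mul _) ((gL_mul_int _).const_mul _),
    intervalIntegral.integral_const_mul, intervalIntegral.integral_const_mul] at h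
  simp at h
  linarith

lemma moment (n : ℕ) : ∫ t in (0:ℝ)..1, t ^ (4 * n) * gL t
    = poch (1/4) n / poch (3/4) n * PhiL 1 := by
  induction n with
  | zero => simp [poch, PhiL]
  | succ n ih =>
    have h := moment_rec n
    rw [ih] at h
    rw [poch_succ, poch_succ]
    have := (poch_pos (a := 3/4) (by norm_num) n).ne'
    have h3 : (4 * n + 3 : ℝ) ≠ 0 := by positivity
    have h4 : (3 / 4 + n : ℝ) ≠ 0 := by positivity
    apply mul_left_cancel₀ h3
    rw [← h]
    field_simp
    ring

lemma poch_eq (a : ℝ) (n : ℕ) : (ascPochhammer ℝ n).eval a = poch a n := by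
  induction n with
  | zero => simp [poch]
  | succ n ih => rw [ascPochhammer_succ_eval, ih, poch_succ]

lemma binom_sum {y : ℝ} (h0 : 0 ≤ y) (h1 : y < 1) :
    HasSum (fun n : ℕ => poch (1/2) n / (n ! : ℝ) * y ^ n) (1 / Real.sqrt (1 - y)) := by
  have := (Real.one_div_one_sub_rpow_hasFPowerSeriesOnBall_zero (1/2)).hasSum (y := y)
    (by simp [abs_of_nonneg h0, enorm_eq_nnnorm, ← NNReal.coe_lt_coe, h1])
  simp only [FormalMultilinearSeries.ofScalars_apply_eq, zero_add, ← Ring.multichoose_eq] at this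
  rw [Real.sqrt_eq_rpow]
  refine Eq.subst (motive := fun f => HasSum f _) (funext fun n => ?_) this
  symm
  have h := Ring.factorial_nsmul_multichoose_eq_ascPochhammer (1/2 : ℝ) n
  rw [Polynomial.ascPochhammer_smeval_eq_eval, poch_eq, nsmul_eq_mul] at h
  rw [← h, smul_eq_mul]
  field_simp

lemma poch_le (n : ℕ) : poch (1/2) n / (n ! : ℝ) ≤ 1 := by
  rw [div_le_one (by positivity)]
  induction n with
  | zero => simp [poch]
  | succ n ih =>
    rw [poch_succ, Nat.factorial_succ]
    push_cast
    have := (poch_pos (a := 1/2) (by norm_num) n)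
    have h : (0:ℝ) ≤ n := by positivity
    nlinarith

lemma series_int : HasSum (fun n : ℕ => ∫ t in (0:ℝ)..1,
      poch (1/2) n / (n ! : ℝ) * (80/81) ^ n * (t ^ (4 * n) * gL t))
    (∫ t in (0:ℝ)..1, 3 / 5 * hL t) := by
  have hg : ∀ t, 0 ≤ gL t := fun t => by unfold gL; positivity
  apply intervalIntegral.hasSum_integral_of_dominated_convergence
    (fun n t => (80/81) ^ n * gL t)
  · intro n
    apply Measurable.aestronglyMeasurable
    unfold gL; fun_prop
  · intro n
    filter_upwards with t ht
    rw [uIoc_of_le (by norm_num)] at ht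
    have hp := (poch_pos (a := 1/2) (by norm_num) n)
    have h1 := ht.1
    rw [Real.norm_of_nonneg (by have := hg t; positivity)]
    have ht1 : t ^ (4 * n) ≤ 1 := pow_le_one₀ ht.1.le ht.2
    have hc := poch_le n
    calc poch (1/2) n / (n ! : ℝ) * (80/81) ^ n * (t ^ (4 * n) * gL t)
        ≤ 1 * (80/81) ^ n * (1 * gL t) := by
          have := hg t
          gcongr
      _ = _ := by ring
  · filter_upwards with t ht
    exact (summable_geometric_of_lt_one (by norm_num) (by norm_num)).mul_right _
  · simp only [tsum_mul_right]
    exact gL_int01.const_mul _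
  · have : ∀ᵐ x : ℝ, x ≠ 1 := by simp [ae_iff]
    filter_upwards [this] with t ht1 ht
    rw [uIoc_of_le (by norm_num)] at ht
    have h2 : t ∈ Ioo (-1:ℝ) 1 := ⟨by linarith [ht.1], lt_of_le_of_ne ht.2 ht1⟩
    have h3 := pow4_lt h2
    have h40 : 0 ≤ t ^ 4 := by positivity
    have := (binom_sum (y := 80/81 * t ^ 4) (by positivity) (by linarith)).mul_right (gL t)
    have e2 : 3 / 5 * hL t = 1 / Real.sqrt (1 - 80/81 * t ^ 4) * gL t := by
      unfold hL gL
      have e : Real.sqrt (81 - 80 * t ^ 4) = 9 * Real.sqrt (1 - 80/81 * t ^ 4) := by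
        rw [show 81 - 80 * t ^ 4 = 9 ^ 2 * (1 - 80/81 * t ^ 4) by ring,
          Real.sqrt_mul (by norm_num), Real.sqrt_sq (by norm_num)]
      rw [e]
      have a1 : 0 < Real.sqrt (1 - 80/81 * t ^ 4) := Real.sqrt_pos.mpr (by linarith)
      have a2 : 0 < Real.sqrt (1 - t ^ 4) := Real.sqrt_pos.mpr (by linarith)
      generalize Real.sqrt (1 - 80/81 * t ^ 4) = u at *
      field_simp
      norm_num
    rw [e2]
    refine Eq.subst (motive := fun f => HasSum f _) (funext fun n => ?_) this
    symm
    rw [mul_pow, ← pow_mul]; ring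

theorem stmt0 : twoFone (1/4) (1/2) (3/4) (80/81) = 9/5 := by
  have h := series_int
  simp only [intervalIntegral.integral_const_mul, moment, int_hL] at h
  have hA := Phi_one_pos.ne'
  have h2 := h.mul_right (PhiL 1)⁻¹
  unfold twoFone
  have h3 := h2.tsum_eq
  rw [show 3 / 5 * (3 * PhiL 1) * (PhiL 1)⁻¹ = 9 / 5 by field_simp; norm_num] at h3
  rw [← h3]
  apply tsum_congr
  intro n
  have := (poch_pos (a := 3/4) (by norm_num) n).ne'
  field_simp
end

section
/- The Gauss hypergeometric series satisfies ₂F₁(1/3, 2/3; 5/6; 27/32) = 8/5. -/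
open scoped Nat

open MeasureTheory Set

namespace H

lemma rp3 (r : ℝ) (hr : 0 < r) : (r ^ 3) ^ ((1/3 : ℝ) - 1) = 1 / r ^ 2 := by
  rw [← Real.rpow_natCast, ← Real.rpow_mul hr.le, one_div (r ^ _), ← Real.rpow_natCast,
    ← Real.rpow_neg hr.le]
  norm_num

lemma rp3' (r : ℝ) (hr : 0 < r) : (r ^ 3) ^ (-(2/3) : ℝ) = 1 / r ^ 2 := by
  rw [← rp3 r hr]; norm_num

lemma rp2 (r : ℝ) (hr : 0 < r) : (r ^ 2) ^ ((1/2 : ℝ) - 1) = 1 / r := by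
  rw [← Real.rpow_natCast, ← Real.rpow_mul hr.le, one_div r, ← Real.rpow_neg_one]
  congr 1; norm_num

lemma rp6 (r : ℝ) (hr : 0 < r) : (r ^ 6) ^ ((1/6 : ℝ) - 1) = 1 / r ^ 5 := by
  rw [← Real.rpow_natCast, ← Real.rpow_mul hr.le, one_div (r ^ _), ← Real.rpow_natCast,
    ← Real.rpow_neg hr.le]
  norm_num

lemma cbrt (x : ℝ) (hx : 0 < x) : ∃ r : ℝ, 0 < r ∧ x = r ^ 3 :=
  ⟨x ^ (1/3 : ℝ), Real.rpow_pos_of_pos hx _, by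
    rw [← Real.rpow_natCast, ← Real.rpow_mul hx.le]; norm_num⟩

lemma sqrt2 (x : ℝ) (hx : 0 < x) : ∃ r : ℝ, 0 < r ∧ x = r ^ 2 :=
  ⟨√x, Real.sqrt_pos.2 hx, (Real.sq_sqrt hx.le).symm⟩

def P (x : ℝ) : ℝ := 4096 - 41600*x + 118720*x^2 - 149040*x^3 + 87480*x^4 - 19683*x^5
def Q (x : ℝ) : ℝ := 640 - 2080*x + 2160*x^2 - 729*x^3
noncomputable def R (x : ℝ) : ℝ := x * Q x ^ 3 / (16384 * (1-x)^3 * (32-27*x)^2)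
noncomputable def R' (x : ℝ) : ℝ := 5 * Q x ^ 2 * P x / (16384 * (1-x)^4 * (32-27*x)^3)
noncomputable def V (x : ℝ) : ℝ := - (x * Q x ^ 3) / P x ^ 2
noncomputable def V' (x : ℝ) : ℝ := - (5 * 16384 * Q x ^ 2 * (1-x)^2 * (32-27*x)) / P x ^ 3
noncomputable def W (x : ℝ) : ℝ := x ^ ((1/3:ℝ)-1) * (1-x) ^ ((1/2:ℝ)-1) * (1 - 27/32*x) ^ (-(2/3):ℝ)

lemma key (x : ℝ) : 16384 * (1-x)^3 * (32-27*x)^2 - x * Q x ^ 3 = P x ^ 2 := by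
  unfold P Q; ring

lemma hP (x : ℝ) : HasDerivAt P (-41600 + 237440*x - 447120*x^2 + 349920*x^3 - 98415*x^4) x := by
  have := (((((hasDerivAt_const x (4096:ℝ)).sub ((hasDerivAt_id' x).const_mul 41600)).add
    ((hasDerivAt_pow 2 x).const_mul 118720)).sub ((hasDerivAt_pow 3 x).const_mul 149040)).add
    ((hasDerivAt_pow 4 x).const_mul 87480)).sub ((hasDerivAt_pow 5 x).const_mul 19683)
  refine this.congr_deriv ?_
  norm_num; ring

lemma hQ (x : ℝ) : HasDerivAt Q (-2080 + 4320*x - 2187*x^2) x := by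
  have := ((((hasDerivAt_const x (640:ℝ)).sub ((hasDerivAt_id' x).const_mul 2080)).add
    ((hasDerivAt_pow 2 x).const_mul 2160)).sub ((hasDerivAt_pow 3 x).const_mul 729))
  refine this.congr_deriv ?_
  norm_num; ring

lemma hR (x : ℝ) (h1 : x < 1) : HasDerivAt R (R' x) x := by
  have a1 : (1 - x) ≠ 0 := by linarith
  have a2 : (32 - 27*x) ≠ 0 := by linarith
  have n := (hasDerivAt_id' x).mul ((hQ x).pow 3)
  have d := ((((hasDerivAt_id' x).const_sub 1).pow 3).const_mul 16384).mul
    ((((hasDerivAt_id' x).const_mul 27).const_sub 32).pow 2)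
  have := n.div d (by simp [a1, a2])
  refine this.congr_deriv ?_
  simp only [R', Pi.mul_apply, Pi.pow_apply]
  rw [div_eq_div_iff (by simp [a1, a2]) (by simp [a1, a2])]
  unfold P Q
  norm_num
  ring

lemma hV (x : ℝ) (h1 : P x ≠ 0) : HasDerivAt V (V' x) x := by
  have n := ((hasDerivAt_id' x).mul ((hQ x).pow 3)).neg
  have := n.div ((hP x).pow 2) (by simp [h1])
  refine this.congr_deriv ?_
  simp only [V', Pi.mul_apply, Pi.pow_apply, Pi.neg_apply]
  field_simp
  unfold P Q
  norm_num
  ring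

lemma pt1 (x : ℝ) (h0 : 0 < x) (h1 : x < 1) (hq : 0 < Q x) (hp : P x ≠ 0) :
    |R' x| * (R x ^ ((1/3:ℝ)-1) * (1 - R x) ^ ((1/2:ℝ)-1)) = 5/2 * W x := by
  obtain ⟨X, X0, hX⟩ := cbrt x h0
  obtain ⟨A, A0, hA⟩ := sqrt2 (1-x) (by linarith)
  obtain ⟨Z, Z0, hZ⟩ := cbrt (1-27/32*x) (by linarith)
  have hZ' : 32 - 27*x = 32*Z^3 := by linarith
  have e1 : R x = (X * Q x / (256 * A^2 * Z^2))^3 := by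
    unfold R; rw [hZ', hA]; nth_rewrite 1 [hX]; field_simp; try norm_num
  have hpp := abs_pos.2 hp
  have e2 : 1 - R x = (|P x| / (4096 * A^3 * Z^3))^2 := by
    rw [div_pow, sq_abs, ← key x]
    unfold R; rw [hZ', hA]; field_simp; ring
  have e3 : |R' x| = 5 * Q x ^ 2 * |P x| / (16384 * (A^2)^4 * (32*Z^3)^3) := by
    unfold R'; rw [hZ', hA, abs_div, abs_mul, abs_of_pos (show 0 < 5 * Q x ^ 2 by positivity),
      abs_of_pos (show 0 < 16384 * (A^2)^4 * (32*Z^3)^3 by positivity)]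
  have e4 : W x = 1 / X^2 * (1 / A) * (1 / Z^2) := by
    unfold W; rw [hZ, hA, rp2 A A0, rp3' Z Z0]; nth_rewrite 1 [hX]; rw [rp3 X X0]
  rw [e3, e2, e1, e4, rp3 _ (by positivity), rp2 _ (by positivity)]
  field_simp
  norm_num

lemma pt2 (x : ℝ) (h0 : 0 < x) (h1 : x < 1) (hq : Q x < 0) (hp : P x < 0) :
    |V' x| * (V x ^ ((1/3:ℝ)-1) * (1 - V x) ^ ((1/6:ℝ)-1)) = 5/2 * W x := by
  obtain ⟨X, X0, hX⟩ := cbrt x h0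
  obtain ⟨A, A0, hA⟩ := sqrt2 (1-x) (by linarith)
  obtain ⟨Z, Z0, hZ⟩ := cbrt (1-27/32*x) (by linarith)
  obtain ⟨N, N0, hN⟩ := cbrt (-P x) (by linarith)
  have hN' : P x = -N^3 := by linarith
  obtain ⟨q, q0, hq'⟩ : ∃ q : ℝ, 0 < q ∧ Q x = - q := ⟨-Q x, by linarith, by ring⟩
  have hZ' : 32 - 27*x = 32*Z^3 := by linarith
  have hk := key x
  have e1 : V x = (X * q / N^2)^3 := by
    unfold V; rw [hN', hq']; nth_rewrite 1 [hX]; field_simp; try norm_num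
  have e2 : 1 - V x = (16 * A * Z / N)^6 := by
    have : 1 - V x = 16384 * (1-x)^3 * (32-27*x)^2 / P x ^2 := by
      have := hp.ne
      unfold V; field_simp; rw [hk.symm]; try ring
    rw [this, hZ', hA, hN']; field_simp; try norm_num
  have e3 : |V' x| = 5 * 16384 * q^2 * (A^2)^2 * (32*Z^3) / N^9 := by
    have : V' x = 5 * 16384 * q^2 * (A^2)^2 * (32*Z^3) / N^9 := by
      unfold V'; rw [hZ', hA, hN', hq']; field_simp
    rw [this, abs_of_pos (by positivity)]
  have e4 : W x = 1 / X^2 * (1 / A) * (1 / Z^2) := by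
    unfold W; rw [hZ, hA, rp2 A A0, rp3' Z Z0]; nth_rewrite 1 [hX]; rw [rp3 X X0]
  rw [e3, e2, e1, e4, rp3 _ (by positivity), rp6 _ (by positivity)]
  field_simp
  norm_num

lemma cov (a b : ℝ) (hab : a < b) (f f' g h : ℝ → ℝ) (hc : ContinuousOn f (Icc a b))
    (hd : ∀ x ∈ Ioo a b, HasDerivAt f (f' x) x) (hpos : ∀ x ∈ Ioo a b, 0 < f' x)
    (ha : f a = 0) (hb : f b = 1)
    (hg : ∀ x ∈ Ioo a b, |f' x| * g (f x) = 5/2 * h x) :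
    5/2 * ∫ x in Ioo a b, h x = ∫ x in Ioo 0 1, g x := by
  have hm : StrictMonoOn f (Icc a b) := by
    apply strictMonoOn_of_deriv_pos (convex_Icc a b) hc
    rw [interior_Icc]; intro x hx; rw [(hd x hx).deriv]; exact hpos x hx
  have him : f '' Ioo a b = Ioo 0 1 := by
    apply Subset.antisymm
    · rintro _ ⟨x, hx, rfl⟩
      have h1 := hm (left_mem_Icc.2 hab.le) (Ioo_subset_Icc_self hx) hx.1
      have h2 := hm (Ioo_subset_Icc_self hx) (right_mem_Icc.2 hab.le) hx.2
      rw [ha] at h1; rw [hb] at h2; exact ⟨h1, h2⟩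
    · have := intermediate_value_Ioo hab.le hc
      rwa [ha, hb] at this
  rw [← him, integral_image_eq_integral_abs_deriv_smul measurableSet_Ioo
    (fun x hx => (hd x hx).hasDerivWithinAt) (hm.injOn.mono Ioo_subset_Icc_self),
    ← integral_const_mul]
  exact setIntegral_congr_fun measurableSet_Ioo (fun x hx => (hg x hx).symm)

lemma cov' (a b : ℝ) (hab : a < b) (f f' g h : ℝ → ℝ) (hc : ContinuousOn f (Icc a b))
    (hd : ∀ x ∈ Ioo a b, HasDerivAt f (f' x) x) (hpos : ∀ x ∈ Ioo a b, f' x < 0)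
    (ha : f a = 1) (hb : f b = 0)
    (hg : ∀ x ∈ Ioo a b, |f' x| * g (f x) = 5/2 * h x) :
    5/2 * ∫ x in Ioo a b, h x = ∫ x in Ioo 0 1, g x := by
  have hm : StrictAntiOn f (Icc a b) := by
    apply strictAntiOn_of_deriv_neg (convex_Icc a b) hc
    rw [interior_Icc]; intro x hx; rw [(hd x hx).deriv]; exact hpos x hx
  have him : f '' Ioo a b = Ioo 0 1 := by
    apply Subset.antisymm
    · rintro _ ⟨x, hx, rfl⟩
      have h1 := hm (left_mem_Icc.2 hab.le) (Ioo_subset_Icc_self hx) hx.1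
      have h2 := hm (Ioo_subset_Icc_self hx) (right_mem_Icc.2 hab.le) hx.2
      rw [ha] at h1; rw [hb] at h2; exact ⟨h2, h1⟩
    · have := intermediate_value_Ioo' hab.le hc
      rwa [ha, hb] at this
  rw [← him, integral_image_eq_integral_abs_deriv_smul measurableSet_Ioo
    (fun x hx => (hd x hx).hasDerivWithinAt) (hm.injOn.mono Ioo_subset_Icc_self),
    ← integral_const_mul]
  exact setIntegral_congr_fun measurableSet_Ioo (fun x hx => (hg x hx).symm)

lemma Proot : ∃ c : ℝ, 0 < c ∧ c < 1/5 ∧ P c = 0 ∧ (∀ x, 0 ≤ x → x < c → 0 < P x) ∧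
    (∀ x, c < x → x ≤ 1 → P x < 0) := by
  have hc : Continuous P := by unfold P; fun_prop
  have hm : StrictAntiOn P (Icc 0 (1/5)) := by
    apply strictAntiOn_of_deriv_neg (convex_Icc _ _) hc.continuousOn
    rw [interior_Icc]; intro x hx; rw [(hP x).deriv]
    obtain ⟨h0, h1⟩ := hx
    have : x^3 ≤ x^2 * (1/5) := by nlinarith [sq_nonneg x]
    nlinarith [sq_nonneg (x^2), sq_nonneg x]
  have := intermediate_value_Ioo' (show (0:ℝ) ≤ 1/5 by norm_num) hc.continuousOn
  obtain ⟨c, hc1, hc2⟩ := this (show (0:ℝ) ∈ _ by constructor <;> norm_num [P])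
  refine ⟨c, hc1.1, hc1.2, hc2, ?_, ?_⟩
  · intro x h0 h1
    rw [← hc2]; exact hm ⟨h0, by linarith [hc1.2]⟩ (Ioo_subset_Icc_self hc1) h1
  · intro x h0 h1
    rcases le_total x (1/5) with h | h
    · rw [← hc2]; exact hm (Ioo_subset_Icc_self hc1) ⟨by linarith [hc1.1], h⟩ h0
    · have u := sub_nonneg.2 h
      have v := sub_nonneg.2 h1
      have k0 := pow_nonneg v 5
      have k1 := mul_nonneg u (pow_nonneg v 4)
      have k2 := mul_nonneg (pow_nonneg u 2) (pow_nonneg v 3)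
      have k3 := mul_nonneg (pow_nonneg u 3) (pow_nonneg v 2)
      have k4 := mul_nonneg (pow_nonneg u 4) v
      have k5 := pow_nonneg u 5
      unfold P
      nlinarith only [k0, k1, k2, k3, k4, k5]

lemma Qroot : ∃ c : ℝ, 1/5 < c ∧ c < 1 ∧ Q c = 0 ∧ (∀ x, 0 ≤ x → x < c → 0 < Q x) ∧
    (∀ x, c < x → x ≤ 1 → Q x < 0) := by
  have hc : Continuous Q := by unfold Q; fun_prop
  have hm : StrictAntiOn Q (Icc 0 (7/10)) := by
    apply strictAntiOn_of_deriv_neg (convex_Icc _ _) hc.continuousOn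
    rw [interior_Icc]; intro x hx; rw [(hQ x).deriv]
    obtain ⟨h0, h1⟩ := hx
    nlinarith
  have := intermediate_value_Ioo' (show (1/5:ℝ) ≤ 7/10 by norm_num) hc.continuousOn
  obtain ⟨c, hc1, hc2⟩ := this (show (0:ℝ) ∈ _ by constructor <;> norm_num [Q])
  have hcm : c ∈ Icc (0:ℝ) (7/10) := ⟨by linarith [hc1.1], hc1.2.le⟩
  refine ⟨c, hc1.1, by linarith [hc1.2], hc2, ?_, ?_⟩
  · intro x h0 h1
    rw [← hc2]; exact hm ⟨h0, by linarith [hc1.2]⟩ hcm h1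
  · intro x h0 h1
    rcases le_total x (7/10) with h | h
    · rw [← hc2]; exact hm hcm ⟨by linarith [hc1.1], h⟩ h0
    · unfold Q
      nlinarith [mul_nonneg (sub_nonneg.2 h) (sub_nonneg.2 h1), mul_nonneg (sub_nonneg.2 h) (sq_nonneg (1-x)), mul_nonneg (sub_nonneg.2 h1) (sq_nonneg (x-7/10)), mul_nonneg (sub_nonneg.2 h1) (sq_nonneg (x-8/10)), mul_nonneg (sub_nonneg.2 h) (sq_nonneg (x-8/10))]

lemma betaI (a b : ℝ) (ha : 0 < a) (hb : 0 < b) :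
    ∫ x in Ioo (0:ℝ) 1, x ^ (a-1) * (1-x) ^ (b-1) = Real.Gamma a * Real.Gamma b / Real.Gamma (a+b) := by
  have := Complex.betaIntegral_eq_Gamma_mul_div a b (by simpa) (by simpa)
  rw [← Complex.ofReal_add, Complex.Gamma_ofReal, Complex.Gamma_ofReal, Complex.Gamma_ofReal,
    Complex.betaIntegral, intervalIntegral.integral_of_le zero_le_one, integral_Ioc_eq_integral_Ioo] at this
  apply Complex.ofReal_injective
  push_cast
  rw [← this, ← integral_complex_ofReal]
  apply setIntegral_congr_fun measurableSet_Ioo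
  intro x hx
  have h0 := hx.1.le
  have h1 : 0 ≤ 1 - x := by linarith [hx.2]
  simp only
  push_cast [Complex.ofReal_cpow h0, Complex.ofReal_cpow h1]
  rfl

lemma betaInt (a b : ℝ) (ha : 0 < a) (hb : 0 < b) :
    IntegrableOn (fun x : ℝ => x ^ (a-1) * (1-x) ^ (b-1)) (Ioo (0:ℝ) 1) := by
  by_contra h
  have h1 := integral_undef h
  rw [betaI a b ha hb] at h1
  have := Real.Gamma_pos_of_pos ha
  have := Real.Gamma_pos_of_pos hb
  have := Real.Gamma_pos_of_pos (add_pos ha hb)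
  have : 0 < Real.Gamma a * Real.Gamma b / Real.Gamma (a+b) := by positivity
  linarith

lemma poch_succ (a : ℝ) (n : ℕ) : poch a (n+1) = poch a n * (a + n) := by
  simp [poch, Finset.prod_range_succ]

lemma poch_pos (a : ℝ) (ha : 0 < a) (n : ℕ) : 0 < poch a n :=
  Finset.prod_pos fun i _ => by positivity

lemma Gam (a : ℝ) (ha : 0 < a) (n : ℕ) : Real.Gamma (a + n) = poch a n * Real.Gamma a := by
  induction n with
  | zero => simp [poch]
  | succ n ih =>
    push_cast
    rw [← add_assoc, Real.Gamma_add_one (by positivity), ih, poch_succ]; ring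

lemma poch_choose (a : ℝ) (n : ℕ) : Ring.choose (a + n - 1) n = poch a n / n ! := by
  have h := Ring.factorial_nsmul_multichoose_eq_ascPochhammer a n
  have h2 : (ascPochhammer ℕ n).smeval a = poch a n := by
    rw [← Polynomial.ascPochhammer_smeval_cast ℝ, ← Polynomial.eval_eq_smeval]
    induction n with
    | zero => simp [poch]
    | succ n ih => rw [ascPochhammer_succ_eval, ih (Ring.factorial_nsmul_multichoose_eq_ascPochhammer a n), poch_succ]
  rw [h2, nsmul_eq_mul] at h
  have : (n ! : ℝ) ≠ 0 := by positivity
  rw [eq_div_iff this, ← h, Ring.choose, mul_comm]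
  congr 2; ring

lemma binom (a y : ℝ) (hy : |y| < 1) : HasSum (fun n : ℕ => poch a n / n ! * y ^ n) ((1 - y) ^ (-a)) := by
  have := (Real.one_div_one_sub_rpow_hasFPowerSeriesOnBall_zero a).hasSum (y := y)
    (by simpa [Metric.mem_eball, edist_dist, ← ofReal_norm] using hy)
  simp only [zero_add] at this
  rw [Real.rpow_neg (by linarith [(abs_lt.1 hy).2]), ← one_div]
  have e : (fun n : ℕ => poch a n / n ! * y ^ n) = fun n => (FormalMultilinearSeries.ofScalars ℝ (fun n : ℕ => Ring.choose (a + ↑n - 1) n) n) fun _ => y := by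
    funext n
    simp [FormalMultilinearSeries.ofScalars, poch_choose]
  rw [e]; exact this

lemma euler : twoFone (1/3) (2/3) (5/6) (27/32) *
    (Real.Gamma (1/3) * Real.Gamma (1/2) / Real.Gamma (5/6)) = ∫ x in Ioo (0:ℝ) 1, W x := by
  have hw := betaInt (1/3) (1/2) (by norm_num) (by norm_num)
  set w : ℝ → ℝ := fun x : ℝ => x ^ ((1/3:ℝ)-1) * (1-x) ^ ((1/2:ℝ)-1) with hwdef
  have hs := binom (2/3) (27/32) (by norm_num [abs_of_pos])
  have hnn : ∀ n : ℕ, 0 ≤ poch (2/3) n / n ! := fun n => by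
    have := poch_pos (2/3) (by norm_num) n
    positivity
  have H := hasSum_integral_of_dominated_convergence (μ := volume.restrict (Ioo (0:ℝ) 1))
    (F := fun (n : ℕ) x => poch (2/3) n / n ! * (27/32*x) ^ n * w x) (f := W)
    (fun n x => poch (2/3) n / n ! * (27/32) ^ n * w x)
    (fun n => by
      apply AEStronglyMeasurable.mul _ hw.aestronglyMeasurable
      exact (by fun_prop : Continuous fun x : ℝ => poch (2/3) n / n ! * (27/32*x) ^ n).aestronglyMeasurable)
    (fun n => by
      refine (ae_restrict_mem measurableSet_Ioo).mono fun x hx => ?_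
      have h0 := hx.1
      have h1 : 0 < 1 - x := by linarith [hx.2]
      have hwx : 0 ≤ w x := by positivity
      have := hnn n
      rw [Real.norm_of_nonneg (by positivity)]
      gcongr
      linarith)
    (Filter.Eventually.of_forall fun x => hs.summable.mul_right _)
    (by
      have : (fun a => ∑' n : ℕ, poch (2/3) n / n ! * (27/32 : ℝ) ^ n * w a) = fun a => (∑' n : ℕ, poch (2/3) n / n ! * (27/32 : ℝ) ^ n) * w a := by
        funext a; rw [tsum_mul_right]
      rw [this]
      exact hw.const_mul _)
    (by
      refine (ae_restrict_mem measurableSet_Ioo).mono fun x hx => ?_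
      have := (binom (2/3) (27/32*x) (by rw [abs_of_pos] <;> linarith [hx.1, hx.2])).mul_right (w x)
      have e : W x = (1 - 27/32*x) ^ (-(2/3):ℝ) * w x := by
        simp only [W, hwdef]; ring
      rw [e]; exact this)
  rw [← H.tsum_eq, twoFone, ← tsum_mul_right]
  congr 1; ext n
  have hb := betaI (1/3 + n) (1/2) (by positivity) (by norm_num)
  have e : ∫ x in Ioo (0:ℝ) 1, poch (2/3) n / n ! * (27/32*x) ^ n * w x
      = poch (2/3) n / n ! * (27/32)^n * ∫ x in Ioo (0:ℝ) 1, x ^ ((1/3 + n : ℝ)-1) * (1-x) ^ ((1/2:ℝ)-1) := by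
    rw [← integral_const_mul]
    apply setIntegral_congr_fun measurableSet_Ioo
    intro x hx
    simp only [hwdef]
    rw [show (1/3 + n : ℝ) - 1 = (1/3 - 1) + n by ring, Real.rpow_add_natCast hx.1.ne', mul_pow]
    ring
  rw [e, hb, show (1/3 + n + 1/2 : ℝ) = 5/6 + n by ring, Gam _ (by norm_num), Gam _ (by norm_num)]
  have := poch_pos (5/6) (by norm_num) n
  have := Real.Gamma_pos_of_pos (show (0:ℝ) < 5/6 by norm_num)
  field_simp

lemma beta6 : Real.Gamma (1/3) * Real.Gamma (1/6) / Real.Gamma (1/3+1/6) =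
    2 * (Real.Gamma (1/3) * Real.Gamma (1/2) / Real.Gamma (5/6)) := by
  have h := Real.Gamma_mul_Gamma_one_sub (1/6)
  rw [show Real.pi * (1/6) = Real.pi / 6 by ring] at h
  rw [Real.sin_pi_div_six] at h
  norm_num at h
  have h5 := Real.Gamma_pos_of_pos (show (0:ℝ) < 5/6 by norm_num)
  have h2 := Real.Gamma_one_half_eq
  have hpi : Real.sqrt Real.pi ^ 2 = Real.pi := Real.sq_sqrt Real.pi_pos.le
  have := Real.sqrt_pos.2 Real.pi_pos
  rw [show (1/3+1/6:ℝ) = 1/2 by norm_num, h2]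
  norm_num
  field_simp
  rw [hpi]; linarith

lemma W_int : 5/2 * ∫ x in Ioo (0:ℝ) 1, W x =
    4 * (Real.Gamma (1/3) * Real.Gamma (1/2) / Real.Gamma (5/6)) := by
  obtain ⟨a, a0, a5, hPa, hPpos, hPneg⟩ := Proot
  obtain ⟨b, b5, b1, hQb, hQpos, hQneg⟩ := Qroot
  have hab : a < b := by linarith
  have B2 := betaI (1/3) (1/2) (by norm_num) (by norm_num)
  have B6 := betaI (1/3) (1/6) (by norm_num) (by norm_num)
  rw [show (1/3+1/2:ℝ) = 5/6 by norm_num] at B2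
  rw [beta6] at B6
  have hG : 0 < Real.Gamma (1/3) * Real.Gamma (1/2) / Real.Gamma (5/6) := by
    have := Real.Gamma_pos_of_pos (show (0:ℝ) < 5/6 by norm_num)
    have := Real.Gamma_pos_of_pos (show (0:ℝ) < 1/3 by norm_num)
    have := Real.Gamma_pos_of_pos (show (0:ℝ) < 1/2 by norm_num)
    positivity
  have Ra : R a = 1 := by
    have := key a
    have h1 : (1 - a) ≠ 0 := by linarith
    have h2 : (32 - 27*a) ≠ 0 := by linarith
    rw [hPa] at this
    unfold R; rw [div_eq_one_iff_eq (by positivity)]; linarith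
  have I1 := cov 0 a a0 R R' (fun t => t ^ ((1/3:ℝ)-1) * (1-t) ^ ((1/2:ℝ)-1)) W
    (fun x hx => (hR x (by linarith [hx.2])).continuousAt.continuousWithinAt)
    (fun x hx => hR x (by linarith [hx.2]))
    (fun x hx => by
      have h1 := hPpos x hx.1.le hx.2
      have h2 := hQpos x hx.1.le (by linarith [hx.2])
      have h3 : 0 < 1 - x := by linarith [hx.2]
      have h4 : 0 < 32 - 27*x := by linarith [hx.2]
      unfold R'; positivity)
    (by simp [R]) Ra
    (fun x hx => pt1 x hx.1 (by linarith [hx.2]) (hQpos x hx.1.le (by linarith [hx.2])) (hPpos x hx.1.le hx.2).ne')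
  have I2 := cov' a b hab R R' (fun t => t ^ ((1/3:ℝ)-1) * (1-t) ^ ((1/2:ℝ)-1)) W
    (fun x hx => (hR x (by linarith [hx.2])).continuousAt.continuousWithinAt)
    (fun x hx => hR x (by linarith [hx.2]))
    (fun x hx => by
      have h1 := hPneg x hx.1 (by linarith [hx.2])
      have h2 := hQpos x (by linarith [hx.1]) hx.2
      have h3 : 0 < 1 - x := by linarith [hx.2]
      have h4 : 0 < 32 - 27*x := by linarith [hx.2]
      unfold R'
      exact div_neg_of_neg_of_pos (mul_neg_of_pos_of_neg (by positivity) h1) (by positivity))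
    Ra (by simp [R, hQb])
    (fun x hx => pt1 x (by linarith [hx.1]) (by linarith [hx.2]) (hQpos x (by linarith [hx.1]) hx.2)
      (hPneg x hx.1 (by linarith [hx.2])).ne)
  have I3 := cov b 1 b1 V V' (fun t => t ^ ((1/3:ℝ)-1) * (1-t) ^ ((1/6:ℝ)-1)) W
    (fun x hx => (hV x (hPneg x (by linarith [hx.1]) hx.2).ne).continuousAt.continuousWithinAt)
    (fun x hx => hV x (hPneg x (by linarith [hx.1]) hx.2.le).ne)
    (fun x hx => by
      have h1 := hPneg x (by linarith [hx.1]) hx.2.le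
      have h2 := hQneg x hx.1 hx.2.le
      have h3 : 0 < 1 - x := by linarith [hx.2]
      have h4 : 0 < 32 - 27*x := by linarith [hx.2]
      have h5 : 0 < Q x ^ 2 := sq_pos_of_neg h2
      unfold V'
      exact div_pos_of_neg_of_neg (neg_neg_of_pos (by positivity)) (Odd.pow_neg (by decide) h1))
    (by simp [V, hQb]) (by norm_num [V, P, Q])
    (fun x hx => pt2 x (by linarith [hx.1]) hx.2 (hQneg x hx.1 hx.2.le) (hPneg x (by linarith [hx.1]) hx.2.le))
  rw [B2] at I1 I2
  rw [B6] at I3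
  have int : ∀ s : Set ℝ, (∫ x in s, W x) ≠ 0 → IntegrableOn W s := by
    intro s hs; by_contra h; exact hs (integral_undef h)
  have J1 := int (Ioo 0 a) (by intro h; rw [h] at I1; linarith)
  have J2 := int (Ioo a b) (by intro h; rw [h] at I2; linarith)
  have J3 := int (Ioo b 1) (by intro h; rw [h] at I3; linarith)
  have K : ∀ s t : ℝ, s ≤ t → ∫ x in Ioo s t, W x = ∫ x in s..t, W x := by
    intro s t h; rw [intervalIntegral.integral_of_le h, integral_Ioc_eq_integral_Ioo]
  have L : ∀ s t : ℝ, s ≤ t → IntegrableOn W (Ioo s t) → IntervalIntegrable W volume s t := by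
    intro s t h h'; rwa [intervalIntegrable_iff_integrableOn_Ioo_of_le h]
  have S : ∫ x in Ioo (0:ℝ) 1, W x = (∫ x in Ioo 0 a, W x) + (∫ x in Ioo a b, W x) + ∫ x in Ioo b 1, W x := by
    rw [K 0 1 (by norm_num), K 0 a a0.le, K a b hab.le, K b 1 b1.le,
      intervalIntegral.integral_add_adjacent_intervals (L _ _ a0.le J1) (L _ _ hab.le J2),
      intervalIntegral.integral_add_adjacent_intervals ((L _ _ a0.le J1).trans (L _ _ hab.le J2)) (L _ _ b1.le J3)]
  rw [S]; linarith

end H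

theorem stmt1 : twoFone (1/3) (2/3) (5/6) (27/32) = 8/5 := by
  have h := H.W_int
  rw [← H.euler] at h
  have hG : 0 < Real.Gamma (1/3) * Real.Gamma (1/2) / Real.Gamma (5/6) := by
    have := Real.Gamma_pos_of_pos (show (0:ℝ) < 5/6 by norm_num)
    have := Real.Gamma_pos_of_pos (show (0:ℝ) < 1/3 by norm_num)
    have := Real.Gamma_pos_of_pos (show (0:ℝ) < 1/2 by norm_num)
    positivity
  have : (5/2 * twoFone (1/3) (2/3) (5/6) (27/32) - 4) *
    (Real.Gamma (1/3) * Real.Gamma (1/2) / Real.Gamma (5/6)) = 0 := by linarith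
  rcases mul_eq_zero.1 this with h | h <;> linarith
end

section
/- The Gauss hypergeometric series satisfies ₂F₁(1/3, 1/3; 2/3; 8/9) = (2/3) · 3^{2/3}. -/
open scoped Nat

open MeasureTheory Set

namespace HypAux

lemma poch_pos {a : ℝ} (ha : 0 < a) (n : ℕ) : 0 < poch a n :=
  Finset.prod_pos fun i _ => by positivity

lemma poch_succ (a : ℝ) (n : ℕ) : poch a (n+1) = poch a n * (a + n) := by
  simp [poch, Finset.prod_range_succ]

lemma poch_eq (a : ℝ) (n : ℕ) : (ascPochhammer ℝ n).eval a = poch a n := by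
  induction n with
  | zero => simp [poch]
  | succ n ih => rw [ascPochhammer_succ_eval, poch_succ, ih]

lemma poch_mono {a b : ℝ} (ha : 0 < a) (hab : a ≤ b) (n : ℕ) : poch a n ≤ poch b n :=
  Finset.prod_le_prod (fun i _ => by positivity) (fun i _ => by linarith)

lemma poch_one (n : ℕ) : poch 1 n = n ! := by
  induction n with
  | zero => simp [poch]
  | succ n ih => rw [poch_succ, ih, Nat.factorial_succ]; push_cast; ring

lemma choose_eq (a : ℝ) (n : ℕ) : Ring.choose (a + n - 1) n = poch a n / n ! := by
  rw [← Ring.multichoose_eq]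
  have h := Ring.factorial_nsmul_multichoose_eq_ascPochhammer a n
  rw [Polynomial.ascPochhammer_smeval_eq_eval, poch_eq, nsmul_eq_mul] at h
  rw [← h]
  have : (n ! : ℝ) ≠ 0 := by positivity
  field_simp

lemma binom {a y : ℝ} (hy : |y| < 1) :
    HasSum (fun n : ℕ => poch a n / n ! * y ^ n) (1 / (1 - y) ^ a) := by
  have h := (Real.one_div_one_sub_rpow_hasFPowerSeriesOnBall_zero a).hasSum (y := y)
    (by simpa [enorm_eq_nnnorm] using! hy)
  simpa [FormalMultilinearSeries.ofScalars_apply_eq, choose_eq, mul_comm] using! h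

lemma beta_int {α β : ℝ} (hα : 0 < α) (hβ : 0 < β) :
    ∫ x in Ioo (0:ℝ) 1, x ^ (α - 1) * (1 - x) ^ (β - 1) = ProbabilityTheory.beta α β := by
  rw [ProbabilityTheory.beta_eq_betaIntegralReal α β hα hβ,
      Complex.betaIntegral, intervalIntegral.integral_of_le (by norm_num),
      ← integral_Ioc_eq_integral_Ioo, ← RCLike.re_to_complex, ← integral_re]
  · refine setIntegral_congr_fun measurableSet_Ioc fun x ⟨hx1, hx₂⟩ ↦ ?_
    norm_cast
    rw [← Complex.ofReal_cpow, ← Complex.ofReal_cpow, RCLike.re_to_complex,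
      Complex.re_mul_ofReal, Complex.ofReal_re]
    all_goals linarith
  convert! Complex.betaIntegral_convergent (u := α) (v := β) (by simpa) (by simpa)
  rw [intervalIntegrable_iff_integrableOn_Ioc_of_le (by simp), IntegrableOn]

lemma beta_integrable {α β : ℝ} (hα : 0 < α) (hβ : 0 < β) :
    IntegrableOn (fun x : ℝ => x ^ (α - 1) * (1 - x) ^ (β - 1)) (Ioo (0:ℝ) 1) := by
  apply Integrable.of_integral_ne_zero
  rw [beta_int hα hβ]
  exact (ProbabilityTheory.beta_pos hα hβ).ne'

noncomputable abbrev B : ℝ := ProbabilityTheory.beta (1/3) (1/3)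

lemma B_pos : 0 < B := ProbabilityTheory.beta_pos (by norm_num) (by norm_num)

lemma beta_shift (n : ℕ) :
    ProbabilityTheory.beta (1/3 + n) (1/3) = B * (poch (1/3) n / poch (2/3) n) := by
  induction n with
  | zero => simp [poch, B]
  | succ n ih =>
    have h2 := (poch_pos (a := 2/3) (by norm_num) n).ne'
    have e : ProbabilityTheory.beta (1/3 + (n+1:ℕ)) (1/3)
        = ProbabilityTheory.beta (1/3 + n) (1/3) * ((1/3 + n) / (2/3 + n)) := by
      unfold ProbabilityTheory.beta
      have e1 : (1/3 + ((n+1:ℕ):ℝ)) = (1/3 + n) + 1 := by push_cast; ring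
      have e2 : (1/3 + (n:ℝ)) + 1 + 1/3 = (2/3 + n) + 1 := by ring
      have e3 : (1/3 + (n:ℝ)) + 1/3 = (2/3 + n) := by ring
      rw [e1, e2, e3, Real.Gamma_add_one (by positivity), Real.Gamma_add_one (by positivity)]
      have := (Real.Gamma_pos_of_pos (s := 2/3 + (n:ℝ)) (by positivity)).ne'
      field_simp
    rw [e, ih, poch_succ, poch_succ]
    have : (2/3 + (n:ℝ)) ≠ 0 := by positivity
    field_simp

noncomputable def g (t : ℝ) : ℝ := t ^ (-2/3 : ℝ) * (1 - t) ^ (-2/3 : ℝ)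
noncomputable def h (t : ℝ) : ℝ := g t * (1 / (1 - 8/9*t) ^ (1/3 : ℝ))

lemma int_g : ∫ t in Ioo (0:ℝ) 1, g t = B := by
  rw [B, ← beta_int (by norm_num) (by norm_num)]
  unfold g
  norm_num

noncomputable def term (n : ℕ) (t : ℝ) : ℝ := g t * (poch (1/3) n / n ! * (8/9*t)^n)

lemma term_eq (n : ℕ) {t : ℝ} (ht : t ∈ Ioo (0:ℝ) 1) :
    term n t = (poch (1/3) n / n ! * (8/9)^n) *
      (t ^ ((1/3 + n : ℝ) - 1) * (1-t) ^ ((1/3:ℝ) - 1)) := by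
  have : t ^ ((1/3 + n : ℝ) - 1) = t ^ (-2/3 : ℝ) * t ^ n := by
    rw [← Real.rpow_natCast t n, ← Real.rpow_add ht.1]; congr 1; ring
  rw [this, term, g, mul_pow]
  have : ((1/3:ℝ) - 1) = -2/3 := by norm_num
  rw [this]; ring

lemma term_nonneg (n : ℕ) {t : ℝ} (ht : t ∈ Ioo (0:ℝ) 1) : 0 ≤ term n t := by
  have h1 := ht.1
  have h2 : 0 < 1 - t := by linarith [ht.2]
  have := poch_pos (a := 1/3) (by norm_num) n
  unfold term g
  positivity

lemma term_integrable (n : ℕ) : IntegrableOn (term n) (Ioo (0:ℝ) 1) := by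
  have := (beta_integrable (α := 1/3 + n) (β := 1/3) (by positivity) (by norm_num)).const_mul
    (poch (1/3) n / n ! * (8/9)^n)
  exact IntegrableOn.congr_fun this (fun t ht => (term_eq n ht).symm) measurableSet_Ioo

noncomputable abbrev c (n : ℕ) : ℝ :=
  poch (1/3) n * poch (1/3) n / (poch (2/3) n * (n ! : ℝ)) * (8/9) ^ n

lemma term_int (n : ℕ) : ∫ t in Ioo (0:ℝ) 1, term n t = B * c n := by
  rw [setIntegral_congr_fun measurableSet_Ioo (fun t ht => term_eq n ht), integral_const_mul,
    beta_int (by positivity) (by norm_num), beta_shift]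
  have h2 := (poch_pos (a := 2/3) (by norm_num) n).ne'
  have : (n ! : ℝ) ≠ 0 := by positivity
  unfold c
  field_simp

lemma c_nonneg (n : ℕ) : 0 ≤ c n := by
  have := poch_pos (a := 1/3) (by norm_num) n
  have := poch_pos (a := 2/3) (by norm_num) n
  unfold c
  positivity

lemma c_summable : Summable c := by
  refine Summable.of_nonneg_of_le c_nonneg (fun n => ?_)
    (summable_geometric_of_lt_one (r := 8/9) (by norm_num) (by norm_num))
  have h1 := poch_pos (a := 1/3) (by norm_num) n
  have h2 := poch_pos (a := 2/3) (by norm_num) n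
  have h3 : poch (1/3) n ≤ poch (2/3) n := poch_mono (by norm_num) (by norm_num) n
  have h4 : poch (1/3) n ≤ n ! := poch_one n ▸ poch_mono (by norm_num) (by norm_num) n
  unfold c
  apply mul_le_of_le_one_left (by positivity)
  rw [div_le_one (by positivity)]
  gcongr

lemma hasSum_h : HasSum (fun n => B * c n) (∫ t in Ioo (0:ℝ) 1, h t) := by
  have key := hasSum_integral_of_summable_integral_norm
    (μ := volume.restrict (Ioo (0:ℝ) 1)) (F := term) term_integrable (by
      have : (fun n => ∫ t in Ioo (0:ℝ) 1, ‖term n t‖) = fun n => B * c n := by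
        funext n
        rw [← term_int]
        exact setIntegral_congr_fun measurableSet_Ioo
          (fun t ht => Real.norm_of_nonneg (term_nonneg n ht))
      rw [this]
      exact c_summable.mul_left B)
  have e : ∫ t in Ioo (0:ℝ) 1, (∑' n, term n t) = ∫ t in Ioo (0:ℝ) 1, h t := by
    refine setIntegral_congr_fun measurableSet_Ioo (fun t ht => ?_)
    have hy : |8/9*t| < 1 := by
      rw [abs_lt]; constructor <;> linarith [ht.1, ht.2]
    exact ((binom (a := 1/3) hy).mul_left (g t)).tsum_eq
  rw [e] at key
  simpa only [term_int] using key

lemma h_integrable : IntegrableOn h (Ioo (0:ℝ) 1) := by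
  apply Integrable.of_integral_ne_zero
  have := le_hasSum hasSum_h 0 (fun n _ => mul_nonneg B_pos.le (c_nonneg n))
  have h0 : c 0 = 1 := by simp [c, poch]
  rw [h0] at this
  have := B_pos
  linarith

lemma cube1 {x : ℝ} (hx : 0 < x) : (x ^ (-2/3 : ℝ))^3 = 1 / x^2 := by
  rw [← Real.rpow_natCast, ← Real.rpow_mul hx.le]
  norm_num

lemma cube2 {x : ℝ} (hx : 0 < x) : (x ^ (1/3 : ℝ))^3 = x := by
  rw [← Real.rpow_natCast, ← Real.rpow_mul hx.le]
  norm_num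

lemma h_cube {t : ℝ} (ht : t ∈ Ioo (0:ℝ) 1) :
    (3 ^ (1/3 : ℝ) * h t)^3 = 3 / (t^2 * (1-t)^2 * (1 - 8/9*t)) := by
  have h1 := ht.1
  have h2 : 0 < 1 - t := by linarith [ht.2]
  have h3 : 0 < 1 - 8/9*t := by linarith [ht.2]
  rw [h, g, mul_pow, mul_pow, mul_pow, div_pow, cube2 h3, cube1 h1, cube1 h2, cube2 (by norm_num)]
  field_simp

lemma h_nonneg {t : ℝ} (ht : t ∈ Ioo (0:ℝ) 1) : 0 ≤ 3 ^ (1/3 : ℝ) * h t := by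
  have h1 := ht.1
  have h2 : 0 < 1 - t := by linarith [ht.2]
  have h3 : 0 < 1 - 8/9*t := by linarith [ht.2]
  unfold h g
  positivity

lemma g_cube {s : ℝ} (h0 : 0 < s) (h1 : 0 < 1 - s) : (g s)^3 = 1/(s^2*(1-s)^2) := by
  rw [g, mul_pow, cube1 h0, cube1 h1]
  field_simp

lemma g_nonneg {s : ℝ} (h0 : 0 < s) (h1 : 0 < 1 - s) : 0 ≤ g s := by
  unfold g; positivity

noncomputable def R (t : ℝ) : ℝ := t*(9-8*t)^2/(27*(1-t))
noncomputable def R' (t : ℝ) : ℝ := (3-4*t)^2*(9-8*t)/(27*(1-t)^2)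
noncomputable def S (t : ℝ) : ℝ := 27*(1-t)/(t*(9-8*t)^2)
noncomputable def S' (t : ℝ) : ℝ := -(27*(3-4*t)^2/(t^2*(9-8*t)^3))

lemma one_sub_R {t : ℝ} (ht : 1 - t ≠ 0) : 1 - R t = (3-4*t)^3/(27*(1-t)) := by
  unfold R; field_simp; ring

lemma one_sub_S {t : ℝ} (h0 : t ≠ 0) (h9 : 9-8*t ≠ 0) :
    1 - S t = (4*t-3)^3/(t*(9-8*t)^2) := by
  unfold S
  rw [eq_div_iff (by positivity), sub_mul, div_mul_cancel₀ _ (by positivity)]; ring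

lemma hasDeriv_R {t : ℝ} (ht : 1 - t ≠ 0) : HasDerivAt R (R' t) t := by
  have e1 : HasDerivAt (fun t : ℝ => 9 - 8*t) (-8) t := by
    simpa using ((hasDerivAt_id t).const_mul 8).const_sub 9
  have e2 : HasDerivAt (fun t : ℝ => 27*(1-t)) (-27) t := by
    simpa using ((hasDerivAt_id t).const_sub 1).const_mul 27
  have := ((hasDerivAt_id t).mul (e1.pow 2)).div e2 (by simpa using ht)
  convert! this using 1
  simp [R']
  field_simp
  ring

lemma hasDeriv_S {t : ℝ} (h0 : t ≠ 0) (h9 : 9-8*t ≠ 0) : HasDerivAt S (S' t) t := by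
  have e1 : HasDerivAt (fun t : ℝ => 9 - 8*t) (-8) t := by
    simpa using ((hasDerivAt_id t).const_mul 8).const_sub 9
  have e2 : HasDerivAt (fun t : ℝ => 27*(1-t)) (-27) t := by
    simpa using ((hasDerivAt_id t).const_sub 1).const_mul 27
  have := e2.div ((hasDerivAt_id t).mul (e1.pow 2)) (by simp [h0, h9])
  convert! this using 1
  simp [S']
  field_simp
  ring

lemma piece1 : B = 3 ^ (1/3 : ℝ) * ∫ t in Ioo (0:ℝ) (3/4), h t := by
  have hc : ContinuousOn R (Icc 0 (3/4)) := fun t ht =>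
    (hasDeriv_R (by linarith [ht.2] : (0:ℝ) < 1 - t).ne').continuousAt.continuousWithinAt
  have hmono : StrictMonoOn R (Icc 0 (3/4)) := by
    refine strictMonoOn_of_deriv_pos (convex_Icc _ _) hc fun t ht => ?_
    rw [interior_Icc] at ht
    have h1 : 0 < 1 - t := by linarith [ht.2]
    have h2 : 0 < 3 - 4*t := by linarith [ht.2]
    have h3 : 0 < 9 - 8*t := by linarith [ht.2]
    rw [(hasDeriv_R h1.ne').deriv, R']
    positivity
  have himg : R '' Ioo 0 (3/4) = Ioo 0 1 := by
    apply Subset.antisymm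
    · rintro _ ⟨t, ht, rfl⟩
      have h0 := ht.1
      have h1 : 0 < 1 - t := by linarith [ht.2]
      have h2 : 0 < 3 - 4*t := by linarith [ht.2]
      have h3 : 0 < 9 - 8*t := by linarith [ht.2]
      constructor
      · unfold R; positivity
      · rw [← sub_pos, one_sub_R h1.ne']; positivity
    · have := intermediate_value_Ioo (by norm_num) hc
      have e0 : R 0 = 0 := by norm_num [R]
      have e1 : R (3/4) = 1 := by norm_num [R]
      rwa [e0, e1] at this
  have cov := integral_image_eq_integral_abs_deriv_smul (f := R) (f' := R') (s := Ioo 0 (3/4))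
    measurableSet_Ioo
    (fun t ht => (hasDeriv_R (by linarith [ht.2] : (0:ℝ) < 1 - t).ne').hasDerivWithinAt)
    (hmono.injOn.mono Ioo_subset_Icc_self) g
  rw [himg, int_g] at cov
  rw [cov, ← integral_const_mul]
  refine setIntegral_congr_fun measurableSet_Ioo fun t ht => ?_
  have h0 := ht.1
  have h1 : 0 < 1 - t := by linarith [ht.2]
  have h2 : 0 < 3 - 4*t := by linarith [ht.2]
  have h3 : 0 < 9 - 8*t := by linarith [ht.2]
  have h4 : 0 < 1 - 8/9*t := by linarith [ht.2]
  have hR : 0 < R t := by unfold R; positivity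
  have hR1 : 0 < 1 - R t := by rw [one_sub_R h1.ne']; positivity
  have htt : t ∈ Ioo (0:ℝ) 1 := ⟨h0, by linarith⟩
  refine (pow_left_inj₀ (mul_nonneg (abs_nonneg _) (g_nonneg hR hR1)) (h_nonneg htt)
    (n := 3) (by norm_num)).1 ?_
  have hR' : 0 < R' t := by unfold R'; positivity
  rw [h_cube htt, mul_pow, abs_of_pos hR', g_cube hR hR1, one_sub_R h1.ne', R, R']
  have h5 : 1 - 8/9*t = (9-8*t)/9 := by ring
  rw [h5]
  field_simp
  try norm_num

lemma piece2 : B = 3 ^ (1/3 : ℝ) * ∫ t in Ioo (3/4 : ℝ) 1, h t := by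
  have hd : ∀ t ∈ Icc (3/4 : ℝ) 1, HasDerivAt S (S' t) t := fun t ht =>
    hasDeriv_S (by linarith [ht.1] : (0:ℝ) < t).ne' (by linarith [ht.2] : (0:ℝ) < 9 - 8*t).ne'
  have hc : ContinuousOn S (Icc (3/4) 1) := fun t ht => (hd t ht).continuousAt.continuousWithinAt
  have hmono : StrictAntiOn S (Icc (3/4) 1) := by
    refine strictAntiOn_of_deriv_neg (convex_Icc _ _) hc fun t ht => ?_
    rw [interior_Icc] at ht
    have h0 : 0 < t := by linarith [ht.1]
    have h2 : 3 - 4*t ≠ 0 := by linarith [ht.1]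
    have h3 : 0 < 9 - 8*t := by linarith [ht.2]
    rw [(hd t (Ioo_subset_Icc_self ht)).deriv, S', neg_lt_zero]
    positivity
  have himg : S '' Ioo (3/4) 1 = Ioo 0 1 := by
    apply Subset.antisymm
    · rintro _ ⟨t, ht, rfl⟩
      have h0 : 0 < t := by linarith [ht.1]
      have h1 : 0 < 1 - t := by linarith [ht.2]
      have h2 : 0 < 4*t-3 := by linarith [ht.1]
      have h3 : 0 < 9 - 8*t := by linarith [ht.2]
      constructor
      · unfold S; positivity
      · rw [← sub_pos, one_sub_S h0.ne' h3.ne']; positivity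
    · have := intermediate_value_Ioo' (by norm_num) hc
      have e0 : S 1 = 0 := by norm_num [S]
      have e1 : S (3/4) = 1 := by norm_num [S]
      rwa [e0, e1] at this
  have cov := integral_image_eq_integral_abs_deriv_smul (f := S) (f' := S') (s := Ioo (3/4) 1)
    measurableSet_Ioo
    (fun t ht => (hd t (Ioo_subset_Icc_self ht)).hasDerivWithinAt)
    (hmono.injOn.mono Ioo_subset_Icc_self) g
  rw [himg, int_g] at cov
  rw [cov, ← integral_const_mul]
  refine setIntegral_congr_fun measurableSet_Ioo fun t ht => ?_
  have h0 : 0 < t := by linarith [ht.1]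
  have h1 : 0 < 1 - t := by linarith [ht.2]
  have h2 : 0 < 4*t-3 := by linarith [ht.1]
  have h3 : 0 < 9 - 8*t := by linarith [ht.2]
  have h4 : 0 < 1 - 8/9*t := by linarith [ht.2]
  have hS : 0 < S t := by unfold S; positivity
  have hS1 : 0 < 1 - S t := by rw [one_sub_S h0.ne' h3.ne']; positivity
  have htt : t ∈ Ioo (0:ℝ) 1 := ⟨h0, by linarith⟩
  refine (pow_left_inj₀ (mul_nonneg (abs_nonneg _) (g_nonneg hS hS1)) (h_nonneg htt)
    (n := 3) (by norm_num)).1 ?_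
  have hS' : |S' t| = 27*(4*t-3)^2/(t^2*(9-8*t)^3) := by
    have e : (3-4*t)^2 = (4*t-3)^2 := by ring
    rw [S', e, abs_neg, abs_of_pos (by positivity)]
  rw [h_cube htt, mul_pow, hS', g_cube hS hS1, one_sub_S h0.ne' h3.ne', S]
  have h5 : 1 - 8/9*t = (9-8*t)/9 := by ring
  rw [h5]
  field_simp
  try norm_num

lemma total : 2 * B = 3 ^ (1/3 : ℝ) * ∫ t in Ioo (0:ℝ) 1, h t := by
  have hi := h_integrable
  have e : ∫ t in Ioo (0:ℝ) 1, h t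
      = (∫ t in Ioo (0:ℝ) (3/4), h t) + ∫ t in Ioo (3/4:ℝ) 1, h t := by
    rw [← integral_Ioc_eq_integral_Ioo (x := (0:ℝ)) (y := 3/4), ← setIntegral_union
      (by rw [Set.disjoint_left]; intro x hx hy; exact absurd hx.2 (not_le.2 hy.1))
      measurableSet_Ioo
      (hi.mono_set (fun x hx => ⟨hx.1, by linarith [hx.2]⟩))
      (hi.mono_set (fun x hx => ⟨by linarith [hx.1], hx.2⟩)),
      Ioc_union_Ioo_eq_Ioo (by norm_num) (by norm_num)]
  rw [e, mul_add, ← piece1, ← piece2]; ring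

end HypAux

open HypAux in
theorem stmt6 : twoFone (1/3) (1/3) (2/3) (8/9) = (2/3) * (3:ℝ) ^ ((2:ℝ)/3) := by
  have h1 : twoFone (1/3) (1/3) (2/3) (8/9) = ∑' n, c n := rfl
  have h2 : B * ∑' n, c n = ∫ t in Ioo (0:ℝ) 1, h t := by
    rw [← tsum_mul_left]; exact hasSum_h.tsum_eq
  have h3 := total
  rw [← h2] at h3
  have h4 : (3:ℝ) ^ (1/3 : ℝ) * 3 ^ ((2:ℝ)/3) = 3 := by
    rw [← Real.rpow_add (by norm_num)]; norm_num
  have h5 : (3:ℝ) ^ (1/3 : ℝ) * ∑' n, c n = 2 := by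
    apply mul_left_cancel₀ B_pos.ne'
    linarith
  have h6 : (0:ℝ) < 3 ^ (1/3 : ℝ) := by positivity
  rw [h1]
  apply mul_left_cancel₀ h6.ne'
  linarith
end
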